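/- arXiv:2601.17501 — 3 statements merged into one kernel-verified Lean document; each statement's English description precedes it below -/
import Mathlib

section
/- Assume the unimodality hypothesis. If L₀ ≥ 0 and L₁ < 0, then there exists p₁ ∈ (0,1) such that the ratio p ↦ ψ(p)/φ(p) is monotone nondecreasing on (0,p₁) and monotone nonincreasing on (p₁,1). (Theorem 2.1, Case 2.) -/
open Set Filter Topology MeasureTheory intervalIntegral

/-- Cauchy's mean value theorem with the ratio of derivatives named `r`. -/
theorem exists_sub_eq_ratio_mul_sub {φ ψ φ' ψ' r : ℝ → ℝ} {a b : ℝ} (hab : a < b)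
    (hφd : ∀ p ∈ Icc a b, HasDerivAt φ (φ' p) p)
    (hψd : ∀ p ∈ Icc a b, HasDerivAt ψ (ψ' p) p)
    (hφ'pos : ∀ p ∈ Icc a b, 0 < φ' p)
    (hr : ∀ p ∈ Icc a b, r p = ψ' p / φ' p) :
    ∃ c ∈ Ioo a b, ψ b - ψ a = r c * (φ b - φ a) := by
  obtain ⟨c, hc, h⟩ := exists_ratio_hasDerivAt_eq_ratio_slope ψ ψ' hab
    (fun x hx => (hψd x hx).continuousAt.continuousWithinAt)
    (fun x hx => hψd x (Ioo_subset_Icc_self hx)) φ φ'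
    (fun x hx => (hφd x hx).continuousAt.continuousWithinAt)
    (fun x hx => hφd x (Ioo_subset_Icc_self hx))
  have hc' := Ioo_subset_Icc_self hc
  have hpos := hφ'pos c hc'
  refine ⟨c, hc, ?_⟩
  rw [hr c hc']
  field_simp
  linarith

/-- A strictly increasing function on `(0, 1)` with nonnegative limit at `0` is positive. -/
theorem StrictMonoOn.pos_of_tendsto_nhdsGT {φ : ℝ → ℝ} {l : ℝ} (hφ : StrictMonoOn φ (Ioo 0 1))
    (hl : Tendsto φ (𝓝[>] (0:ℝ)) (𝓝 l)) (hl0 : 0 ≤ l) : ∀ p ∈ Ioo (0:ℝ) 1, 0 < φ p := by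
  intro p hp
  have hp2 : p / 2 ∈ Ioo (0:ℝ) 1 := ⟨by linarith [hp.1], by linarith [hp.1, hp.2]⟩
  have hle : l ≤ φ (p / 2) := by
    refine le_of_tendsto hl ?_
    filter_upwards [Ioo_mem_nhdsGT hp2.1] with q hq
    exact (hφ ⟨hq.1, hq.2.trans hp2.2⟩ hp2 hq.2).le
  linarith [hφ hp2 hp (by linarith [hp.1])]

theorem stmt5
    (φ ψ φ' ψ' r δ : ℝ → ℝ)
    (hφd : ∀ p ∈ Ioo (0:ℝ) 1, HasDerivAt φ (φ' p) p)
    (hψd : ∀ p ∈ Ioo (0:ℝ) 1, HasDerivAt ψ (ψ' p) p)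
    (hφ'pos : ∀ p ∈ Ioo (0:ℝ) 1, 0 < φ' p)
    (hψ'pos : ∀ p ∈ Ioo (0:ℝ) 1, 0 < ψ' p)
    (hr : ∀ p ∈ Ioo (0:ℝ) 1, r p = ψ' p / φ' p)
    (hrc : ContinuousOn r (Ioo 0 1))
    (lX lY : ℝ)
    (hlX : Tendsto φ (𝓝[>] (0:ℝ)) (𝓝 lX))
    (hlY : Tendsto ψ (𝓝[>] (0:ℝ)) (𝓝 lY))
    (hlX0 : 0 ≤ lX) (hlY0 : 0 ≤ lY)
    (hδ : ∀ p ∈ Ioo (0:ℝ) 1, δ p = φ p * r p - ψ p)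
    (pstar : ℝ) (hpstar : pstar ∈ Ioo (0:ℝ) 1)
    (hrup : MonotoneOn r (Ioo 0 pstar))
    (hrdown : AntitoneOn r (Ioo pstar 1))
    (L₀ L₁ : EReal)
    (hL₀ : Tendsto (fun q => (δ q : EReal)) (𝓝[>] (0:ℝ)) (𝓝 L₀))
    (hL₁ : Tendsto (fun q => (δ q : EReal)) (𝓝[<] (1:ℝ)) (𝓝 L₁))
    (h0 : 0 ≤ L₀) (h1 : L₁ < 0) :
    ∃ p₁ ∈ Ioo (0:ℝ) 1,
      MonotoneOn (fun t => ψ t / φ t) (Ioo 0 p₁) ∧ AntitoneOn (fun t => ψ t / φ t) (Ioo p₁ 1) := by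
  have hφmono : StrictMonoOn φ (Ioo 0 1) := by
    refine strictMonoOn_of_deriv_pos (convex_Ioo 0 1)
      (fun x hx => (hφd x hx).continuousAt.continuousWithinAt) ?_
    rw [interior_Ioo]
    intro x hx
    rw [(hφd x hx).deriv]
    exact hφ'pos x hx
  have hφpos := hφmono.pos_of_tendsto_nhdsGT hlX hlX0
  have mvt : ∀ a ∈ Ioo (0:ℝ) 1, ∀ b ∈ Ioo (0:ℝ) 1, a < b →
      ∃ c ∈ Ioo a b, ψ b - ψ a = r c * (φ b - φ a) := by
    intro a ha b hb hab
    have hsub : Icc a b ⊆ Ioo (0:ℝ) 1 := Icc_subset_Ioo ha.1 hb.2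
    exact exists_sub_eq_ratio_mul_sub hab (fun p hp => hφd p (hsub hp))
      (fun p hp => hψd p (hsub hp)) (fun p hp => hφ'pos p (hsub hp)) (fun p hp => hr p (hsub hp))
  have hδup : ∀ a b, 0 < a → a < b → b < pstar → δ a ≤ δ b := by
    intro a b ha hab hb
    have ha1 : a ∈ Ioo (0:ℝ) 1 := ⟨ha, by linarith [hpstar.2]⟩
    have hb1 : b ∈ Ioo (0:ℝ) 1 := ⟨by linarith, by linarith [hpstar.2]⟩
    obtain ⟨c, hc, h⟩ := mvt a ha1 b hb1 hab
    have hcb : r c ≤ r b := hrup ⟨by linarith [hc.1], hc.2.trans hb⟩ ⟨hb1.1, hb⟩ hc.2.le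
    have hab' : r a ≤ r b := hrup ⟨ha, hab.trans hb⟩ ⟨hb1.1, hb⟩ hab.le
    rw [hδ a ha1, hδ b hb1]
    have e1 := mul_le_mul_of_nonneg_right hcb (sub_nonneg.2 (hφmono ha1 hb1 hab).le)
    have e2 := mul_le_mul_of_nonneg_left hab' (hφpos a ha1).le
    nlinarith
  have hδdown : ∀ a b, pstar < a → a < b → b < 1 → δ b ≤ δ a := by
    intro a b ha hab hb
    have ha1 : a ∈ Ioo (0:ℝ) 1 := ⟨by linarith [hpstar.1], by linarith⟩
    have hb1 : b ∈ Ioo (0:ℝ) 1 := ⟨by linarith [ha1.1], hb⟩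
    obtain ⟨c, hc, h⟩ := mvt a ha1 b hb1 hab
    have hcb : r b ≤ r c := hrdown ⟨by linarith [hc.1], hc.2.trans hb⟩ ⟨ha.trans hab, hb⟩ hc.2.le
    have hab' : r b ≤ r a := hrdown ⟨ha, hab.trans hb⟩ ⟨ha.trans hab, hb⟩ hab.le
    rw [hδ a ha1, hδ b hb1]
    have e1 := mul_le_mul_of_nonneg_right hcb (sub_nonneg.2 (hφmono ha1 hb1 hab).le)
    have e2 := mul_le_mul_of_nonneg_left hab' (hφpos a ha1).le
    nlinarith
  have hδleft : ∀ p, 0 < p → p < pstar → 0 ≤ δ p := by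
    intro p hp hpp
    have hle : L₀ ≤ (δ p : EReal) := by
      refine le_of_tendsto hL₀ ?_
      filter_upwards [Ioo_mem_nhdsGT hp] with q hq
      exact EReal.coe_le_coe_iff.2 (hδup q p hq.1 hq.2 hpp)
    exact EReal.coe_nonneg.1 (h0.trans hle)
  have hδstar : 0 ≤ δ pstar := by
    have hcont : ContinuousAt δ pstar := by
      have hnhds : Ioo (0:ℝ) 1 ∈ 𝓝 pstar := isOpen_Ioo.mem_nhds hpstar
      refine (((hφd _ hpstar).continuousAt.mul (hrc.continuousAt hnhds)).sub
        (hψd _ hpstar).continuousAt).congr ?_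
      filter_upwards [hnhds] with q hq
      exact (hδ q hq).symm
    refine ge_of_tendsto (hcont.tendsto.mono_left (nhdsWithin_le_nhds (s := Iio pstar))) ?_
    filter_upwards [Ioo_mem_nhdsLT hpstar.1] with q hq
    exact hδleft q hq.1 hq.2
  obtain ⟨b, hb, hδb⟩ : ∃ b ∈ Ioo pstar 1, δ b < 0 := by
    have hev := (hL₁.eventually (gt_mem_nhds h1)).and (Ioo_mem_nhdsLT hpstar.2)
    obtain ⟨b, hb, hbI⟩ := hev.exists
    exact ⟨b, hbI, EReal.coe_neg'.1 hb⟩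
  let A : Set ℝ := {p | pstar ≤ p ∧ p < 1 ∧ 0 ≤ δ p}
  have hAstar : pstar ∈ A := ⟨le_rfl, hpstar.2, hδstar⟩
  have hAb : b ∈ upperBounds A := by
    rintro p ⟨-, hp1, hp0⟩
    by_contra! hbp
    linarith [hδdown b p hb.1 hbp hp1]
  have hstar_le : pstar ≤ sSup A := le_csSup ⟨b, hAb⟩ hAstar
  have hp₁ : sSup A ∈ Ioo (0:ℝ) 1 :=
    ⟨hpstar.1.trans_le hstar_le, (csSup_le ⟨_, hAstar⟩ hAb).trans_lt hb.2⟩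
  have hpos : ∀ t ∈ Ioo 0 (sSup A), 0 ≤ δ t := by
    intro t ht
    rcases lt_trichotomy t pstar with h | rfl | h
    · exact hδleft t ht.1 h
    · exact hδstar
    · obtain ⟨a, ⟨-, ha1, ha0⟩, hta⟩ := exists_lt_of_lt_csSup ⟨_, hAstar⟩ ht.2
      exact ha0.trans (hδdown t a h hta ha1)
  have hneg : ∀ t ∈ Ioo (sSup A) 1, δ t ≤ 0 := by
    intro t ht
    by_contra! h
    exact (le_csSup ⟨b, hAb⟩ ⟨hstar_le.trans ht.1.le, ht.2, h.le⟩).not_gt ht.1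
  have hderiv : ∀ t ∈ Ioo (0:ℝ) 1,
      HasDerivAt (fun t => ψ t / φ t) (φ' t / φ t ^ 2 * δ t) t := by
    intro t ht
    have hφt := (hφpos t ht).ne'
    have hφ't := (hφ'pos t ht).ne'
    refine ((hψd t ht).fun_div (hφd t ht) hφt).congr_deriv ?_
    rw [hδ t ht, hr t ht]
    field_simp
  have hfac : ∀ t ∈ Ioo (0:ℝ) 1, 0 ≤ φ' t / φ t ^ 2 := fun t ht =>
    div_nonneg (hφ'pos t ht).le (sq_nonneg _)
  have hsub₀ : Ioo 0 (sSup A) ⊆ Ioo (0:ℝ) 1 := Ioo_subset_Ioo_right hp₁.2.le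
  have hsub₁ : Ioo (sSup A) 1 ⊆ Ioo (0:ℝ) 1 := Ioo_subset_Ioo_left hp₁.1.le
  refine ⟨sSup A, hp₁, ?_, ?_⟩
  · refine monotoneOn_of_hasDerivWithinAt_nonneg (f' := fun t => φ' t / φ t ^ 2 * δ t)
      (convex_Ioo _ _) (fun t ht => (hderiv t (hsub₀ ht)).continuousAt.continuousWithinAt)
      ?_ ?_ <;> rw [interior_Ioo] <;> intro t ht
    · exact (hderiv t (hsub₀ ht)).hasDerivWithinAt
    · exact mul_nonneg (hfac t (hsub₀ ht)) (hpos t ht)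
  · refine antitoneOn_of_hasDerivWithinAt_nonpos (f' := fun t => φ' t / φ t ^ 2 * δ t)
      (convex_Ioo _ _) (fun t ht => (hderiv t (hsub₁ ht)).continuousAt.continuousWithinAt)
      ?_ ?_ <;> rw [interior_Ioo] <;> intro t ht
    · exact (hderiv t (hsub₁ ht)).hasDerivWithinAt
    · exact mul_nonpos_of_nonneg_of_nonpos (hfac t (hsub₁ ht)) (hneg t ht)
end

section
/- Assume the unimodality hypothesis. If L₀ < 0, L₁ < 0 and δ(p*) > 0, then there exist p₁, p₂ with 0 < p₁ < p₂ < 1 such that the ratio p ↦ ψ(p)/φ(p) is monotone nonincreasing on (0,p₁), monotone nondecreasing on (p₁,p₂), and monotone nonincreasing on (p₂,1). (Theorem 2.1, Case 4(b).) -/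
open Set Filter Topology MeasureTheory intervalIntegral

/-- If `r` is the ratio of the derivatives of `ψ` and of an increasing nonnegative `φ`, and `r` is
monotone, then `φ * r - ψ` is monotone. -/
theorem monotoneOn_mul_sub_of_hasDerivAt {φ ψ φ' r δ : ℝ → ℝ} {a b : ℝ}
    (hφ : ∀ p ∈ Ioo a b, HasDerivAt φ (φ' p) p)
    (hψ : ∀ p ∈ Ioo a b, HasDerivAt ψ (r p * φ' p) p)
    (hφ' : ∀ p ∈ Ioo a b, 0 < φ' p) (hpos : ∀ p ∈ Ioo a b, 0 ≤ φ p)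
    (hδ : ∀ p ∈ Ioo a b, δ p = φ p * r p - ψ p) (hr : MonotoneOn r (Ioo a b)) :
    MonotoneOn δ (Ioo a b) := by
  intro p hp q hq hpq
  have hsub : Icc p q ⊆ Ioo a b := Icc_subset_Ioo hp.1 hq.2
  have hmono : MonotoneOn (fun t => r q * φ t - ψ t) (Icc p q) := by
    have hd : ∀ t ∈ Icc p q, HasDerivAt (fun t => r q * φ t - ψ t)
        (r q * φ' t - r t * φ' t) t := fun t ht =>
      ((hφ t (hsub ht)).const_mul (r q)).sub (hψ t (hsub ht))
    refine monotoneOn_of_hasDerivWithinAt_nonneg (convex_Icc p q)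
      (fun t ht => (hd t ht).continuousAt.continuousWithinAt)
      (fun t ht => (hd t (interior_subset ht)).hasDerivWithinAt) fun t ht => ?_
    have ht' := interior_subset ht
    rw [← sub_mul]
    exact mul_nonneg (sub_nonneg.2 (hr (hsub ht') hq ht'.2)) (hφ' t (hsub ht')).le
  have h := hmono (left_mem_Icc.2 hpq) (right_mem_Icc.2 hpq) hpq
  have h' := mul_nonneg (hpos p hp) (sub_nonneg.2 (hr hp hq hpq))
  rw [hδ p hp, hδ q hq]
  simp only at h
  linarith

theorem stmt8
    (φ ψ φ' ψ' r δ : ℝ → ℝ)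
    (hφd : ∀ p ∈ Ioo (0:ℝ) 1, HasDerivAt φ (φ' p) p)
    (hψd : ∀ p ∈ Ioo (0:ℝ) 1, HasDerivAt ψ (ψ' p) p)
    (hφ'pos : ∀ p ∈ Ioo (0:ℝ) 1, 0 < φ' p)
    (hψ'pos : ∀ p ∈ Ioo (0:ℝ) 1, 0 < ψ' p)
    (hr : ∀ p ∈ Ioo (0:ℝ) 1, r p = ψ' p / φ' p)
    (hrc : ContinuousOn r (Ioo 0 1))
    (lX lY : ℝ)
    (hlX : Tendsto φ (𝓝[>] (0:ℝ)) (𝓝 lX))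
    (hlY : Tendsto ψ (𝓝[>] (0:ℝ)) (𝓝 lY))
    (hlX0 : 0 ≤ lX) (hlY0 : 0 ≤ lY)
    (hδ : ∀ p ∈ Ioo (0:ℝ) 1, δ p = φ p * r p - ψ p)
    (pstar : ℝ) (hpstar : pstar ∈ Ioo (0:ℝ) 1)
    (hrup : MonotoneOn r (Ioo 0 pstar))
    (hrdown : AntitoneOn r (Ioo pstar 1))
    (L₀ L₁ : EReal)
    (hL₀ : Tendsto (fun q => (δ q : EReal)) (𝓝[>] (0:ℝ)) (𝓝 L₀))
    (hL₁ : Tendsto (fun q => (δ q : EReal)) (𝓝[<] (1:ℝ)) (𝓝 L₁))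
    (h0 : L₀ < 0) (h1 : L₁ < 0) (hstar : 0 < δ pstar) :
    ∃ p₁ p₂ : ℝ, 0 < p₁ ∧ p₁ < p₂ ∧ p₂ < 1 ∧
      AntitoneOn (fun t => ψ t / φ t) (Ioo 0 p₁) ∧ MonotoneOn (fun t => ψ t / φ t) (Ioo p₁ p₂) ∧
      AntitoneOn (fun t => ψ t / φ t) (Ioo p₂ 1) := by
  have hφmono : StrictMonoOn φ (Ioo 0 1) := by
    refine strictMonoOn_of_hasDerivWithinAt_pos (f' := φ') (convex_Ioo 0 1)
      (fun t ht => (hφd t ht).continuousAt.continuousWithinAt)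
      (fun t ht => (hφd t (interior_subset ht)).hasDerivWithinAt)
      (fun t ht => hφ'pos t (interior_subset ht))
  have hφpos : ∀ p ∈ Ioo (0:ℝ) 1, 0 < φ p := by
    intro p hp
    have hp2 : p / 2 ∈ Ioo (0:ℝ) 1 := ⟨half_pos hp.1, by linarith [hp.1, hp.2]⟩
    have hle : lX ≤ φ (p / 2) := by
      refine le_of_tendsto hlX ?_
      filter_upwards [Ioo_mem_nhdsGT hp2.1] with t ht
      exact (hφmono ⟨ht.1, ht.2.trans hp2.2⟩ hp2 ht.2).le
    exact (hlX0.trans hle).trans_lt (hφmono hp2 hp (half_lt_self hp.1))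
  have hψd' : ∀ p ∈ Ioo (0:ℝ) 1, HasDerivAt ψ (r p * φ' p) p := by
    intro p hp
    rw [hr p hp, div_mul_cancel₀ _ (hφ'pos p hp).ne']
    exact hψd p hp
  have hsubl : Ioo 0 pstar ⊆ Ioo (0:ℝ) 1 := Ioo_subset_Ioo_right hpstar.2.le
  have hsubr : Ioo pstar 1 ⊆ Ioo (0:ℝ) 1 := Ioo_subset_Ioo_left hpstar.1.le
  have hδup : MonotoneOn δ (Ioo 0 pstar) :=
    monotoneOn_mul_sub_of_hasDerivAt (fun p hp => hφd p (hsubl hp))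
      (fun p hp => hψd' p (hsubl hp)) (fun p hp => hφ'pos p (hsubl hp))
      (fun p hp => (hφpos p (hsubl hp)).le) (fun p hp => hδ p (hsubl hp)) hrup
  have hδdown : AntitoneOn δ (Ioo pstar 1) := by
    have h := monotoneOn_mul_sub_of_hasDerivAt (ψ := fun t => -ψ t) (r := fun t => -r t)
      (δ := fun t => -δ t) (fun p hp => hφd p (hsubr hp))
      (fun p hp => (hψd' p (hsubr hp)).neg.congr_deriv (neg_mul _ _).symm)
      (fun p hp => hφ'pos p (hsubr hp))
      (fun p hp => (hφpos p (hsubr hp)).le) (fun p hp => by rw [hδ p (hsubr hp)]; ring) hrdown.neg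
    simpa using h.neg
  have hδc : ContinuousOn δ (Ioo 0 1) := by
    refine ContinuousOn.congr (f := fun p => φ p * r p - ψ p) ?_ hδ
    exact (ContinuousOn.mul (fun t ht => (hφd t ht).continuousAt.continuousWithinAt) hrc).sub
      (fun t ht => (hψd t ht).continuousAt.continuousWithinAt)
  obtain ⟨a, haneg, ha⟩ := ((hL₀.eventually_lt_const h0).and
    (Ioo_mem_nhdsGT hpstar.1)).exists
  obtain ⟨b, hbneg, hb⟩ := ((hL₁.eventually_lt_const h1).and
    (Ioo_mem_nhdsLT hpstar.2)).exists
  replace haneg : δ a < 0 := by exact_mod_cast haneg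
  replace hbneg : δ b < 0 := by exact_mod_cast hbneg
  obtain ⟨p₁, hp₁, hδ₁⟩ := intermediate_value_Ioo ha.2.le
    (hδc.mono (Icc_subset_Ioo ha.1 hpstar.2)) ⟨haneg, hstar⟩
  obtain ⟨p₂, hp₂, hδ₂⟩ := intermediate_value_Ioo' hb.1.le
    (hδc.mono (Icc_subset_Ioo hpstar.1 hb.2)) ⟨hbneg, hstar⟩
  have hp₁0 : 0 < p₁ := ha.1.trans hp₁.1
  have hp₂1 : p₂ < 1 := hp₂.2.trans hb.2
  have hd : ∀ t ∈ Ioo (0:ℝ) 1,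
      HasDerivAt (fun t => ψ t / φ t) (φ' t * δ t / φ t ^ 2) t := by
    intro t ht
    refine ((hψd' t ht).div (hφd t ht) (hφpos t ht).ne').congr_deriv ?_
    rw [hδ t ht]
    ring
  have hmono : ∀ c d : ℝ, Ioo c d ⊆ Ioo 0 1 → (∀ t ∈ Ioo c d, 0 ≤ δ t) →
      MonotoneOn (fun t => ψ t / φ t) (Ioo c d) := by
    intro c d hcd hpos
    refine monotoneOn_of_hasDerivWithinAt_nonneg (convex_Ioo c d)
      (fun t ht => (hd t (hcd ht)).continuousAt.continuousWithinAt)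
      (fun t ht => (hd t (hcd (interior_subset ht))).hasDerivWithinAt) fun t ht => ?_
    have ht' := interior_subset ht
    exact div_nonneg (mul_nonneg (hφ'pos t (hcd ht')).le (hpos t ht')) (sq_nonneg _)
  have hanti : ∀ c d : ℝ, Ioo c d ⊆ Ioo 0 1 → (∀ t ∈ Ioo c d, δ t ≤ 0) →
      AntitoneOn (fun t => ψ t / φ t) (Ioo c d) := by
    intro c d hcd hneg
    refine antitoneOn_of_hasDerivWithinAt_nonpos (convex_Ioo c d)
      (fun t ht => (hd t (hcd ht)).continuousAt.continuousWithinAt)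
      (fun t ht => (hd t (hcd (interior_subset ht))).hasDerivWithinAt) fun t ht => ?_
    have ht' := interior_subset ht
    exact div_nonpos_of_nonpos_of_nonneg
      (mul_nonpos_of_nonneg_of_nonpos (hφ'pos t (hcd ht')).le (hneg t ht')) (sq_nonneg _)
  refine ⟨p₁, p₂, hp₁0, hp₁.2.trans hp₂.1, hp₂1,
    hanti _ _ (Ioo_subset_Ioo_right (hp₁.2.trans hpstar.2).le) fun t ht => ?_,
    hmono _ _ (Ioo_subset_Ioo hp₁0.le hp₂1.le) fun t ht => ?_,
    hanti _ _ (Ioo_subset_Ioo_left (hpstar.1.trans hp₂.1).le) fun t ht => ?_⟩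
  · rw [← hδ₁]
    exact hδup ⟨ht.1, ht.2.trans hp₁.2⟩ ⟨hp₁0, hp₁.2⟩ ht.2.le
  · rcases lt_trichotomy t pstar with h | rfl | h
    · rw [← hδ₁]
      exact hδup ⟨hp₁0, hp₁.2⟩ ⟨hp₁0.trans ht.1, h⟩ ht.1.le
    · exact hstar.le
    · rw [← hδ₂]
      exact hδdown ⟨h, ht.2.trans hp₂1⟩ ⟨hp₂.1, hp₂1⟩ ht.2.le
  · rw [← hδ₂]
    exact hδdown ⟨hp₂.1, hp₂1⟩ ⟨hp₂.1.trans ht.1, ht.2⟩ ht.1.le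
end

section
/- Assume the unimodality hypothesis. Then X ≥_* Y — i.e., p ↦ ψ(p)/φ(p) is monotone nonincreasing on (0,1) — if and only if δ(p*) ≤ 0. (Theorem 2.2, part 2.) -/
open Set Filter Topology MeasureTheory intervalIntegral

/-- A strictly increasing function on `(0, 1)` with nonnegative limit at `0⁺` is positive. -/
theorem pos_of_strictMonoOn_of_tendsto {φ : ℝ → ℝ} {l : ℝ}
    (hφ : StrictMonoOn φ (Ioo 0 1))
    (hl : Tendsto φ (𝓝[>] (0:ℝ)) (𝓝 l)) (hl0 : 0 ≤ l) {p : ℝ} (hp : p ∈ Ioo (0:ℝ) 1) :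
    0 < φ p := by
  have hhalf : p / 2 ∈ Ioo (0:ℝ) 1 := ⟨by linarith [hp.1], by linarith [hp.1, hp.2]⟩
  have hle : l ≤ φ (p / 2) := by
    refine le_of_tendsto hl ?_
    filter_upwards [Ioo_mem_nhdsGT hhalf.1] with x hx
    exact (hφ ⟨hx.1, hx.2.trans hhalf.2⟩ hhalf hx.2).le
  have hlt : φ (p / 2) < φ p := hφ hhalf hp (by linarith [hp.1])
  linarith

/-- A continuous function that increases before `m` and decreases after it is maximal at `m`. -/
theorem le_of_monotoneOn_of_antitoneOn {r : ℝ → ℝ} {a b m : ℝ} (hm : m ∈ Ioo a b)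
    (hrc : ContinuousOn r (Ioo a b)) (hup : MonotoneOn r (Ioo a m))
    (hdown : AntitoneOn r (Ioo m b)) {x : ℝ} (hx : x ∈ Ioo a b) : r x ≤ r m := by
  have hc : ContinuousAt r m := hrc.continuousAt (Ioo_mem_nhds hm.1 hm.2)
  rcases lt_trichotomy x m with h | rfl | h
  · refine ge_of_tendsto (hc.mono_left (nhdsWithin_le_nhds (s := Iio m))) ?_
    filter_upwards [Ioo_mem_nhdsLT h] with y hy
    exact hup ⟨hx.1, h⟩ ⟨hx.1.trans hy.1, hy.2⟩ hy.1.le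
  · exact le_rfl
  · refine ge_of_tendsto (hc.mono_left (nhdsWithin_le_nhds (s := Ioi m))) ?_
    filter_upwards [Ioo_mem_nhdsGT h] with y hy
    exact hdown ⟨hy.1, hy.2.trans hx.2⟩ ⟨h, hx.2⟩ hy.2.le

theorem stmt10
    (φ ψ φ' ψ' r δ : ℝ → ℝ)
    (hφd : ∀ p ∈ Ioo (0:ℝ) 1, HasDerivAt φ (φ' p) p)
    (hψd : ∀ p ∈ Ioo (0:ℝ) 1, HasDerivAt ψ (ψ' p) p)
    (hφ'pos : ∀ p ∈ Ioo (0:ℝ) 1, 0 < φ' p)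
    (hψ'pos : ∀ p ∈ Ioo (0:ℝ) 1, 0 < ψ' p)
    (hr : ∀ p ∈ Ioo (0:ℝ) 1, r p = ψ' p / φ' p)
    (hrc : ContinuousOn r (Ioo 0 1))
    (lX lY : ℝ)
    (hlX : Tendsto φ (𝓝[>] (0:ℝ)) (𝓝 lX))
    (hlY : Tendsto ψ (𝓝[>] (0:ℝ)) (𝓝 lY))
    (hlX0 : 0 ≤ lX) (hlY0 : 0 ≤ lY)
    (hδ : ∀ p ∈ Ioo (0:ℝ) 1, δ p = φ p * r p - ψ p)
    (pstar : ℝ) (hpstar : pstar ∈ Ioo (0:ℝ) 1)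
    (hrup : MonotoneOn r (Ioo 0 pstar))
    (hrdown : AntitoneOn r (Ioo pstar 1))
    (L₀ L₁ : EReal)
    (hL₀ : Tendsto (fun q => (δ q : EReal)) (𝓝[>] (0:ℝ)) (𝓝 L₀))
    (hL₁ : Tendsto (fun q => (δ q : EReal)) (𝓝[<] (1:ℝ)) (𝓝 L₁))
 :
    AntitoneOn (fun t => ψ t / φ t) (Ioo 0 1) ↔ δ pstar ≤ 0 := by
  have hφmono : StrictMonoOn φ (Ioo 0 1) :=
    strictMonoOn_of_hasDerivWithinAt_pos (convex_Ioo 0 1)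
      (fun x hx => (hφd x hx).continuousAt.continuousWithinAt)
      (fun x hx => (hφd x (interior_subset hx)).hasDerivWithinAt)
      (fun x hx => hφ'pos x (interior_subset hx))
  have hφpos : ∀ p ∈ Ioo (0:ℝ) 1, 0 < φ p := fun p hp =>
    pos_of_strictMonoOn_of_tendsto hφmono hlX hlX0 hp
  have hrmax : ∀ p ∈ Ioo (0:ℝ) 1, r p ≤ r pstar := fun p hp =>
    le_of_monotoneOn_of_antitoneOn hpstar hrc hrup hrdown hp
  have hmean : ∀ a ∈ Ioo (0:ℝ) 1, ∀ b ∈ Ioo (0:ℝ) 1, a < b →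
      ∃ c ∈ Ioo a b, ψ b - ψ a = r c * (φ b - φ a) := by
    intro a ha b hb hab
    have hsub : Icc a b ⊆ Ioo 0 1 := Icc_subset_Ioo ha.1 hb.2
    obtain ⟨c, hc, h⟩ := exists_ratio_hasDerivAt_eq_ratio_slope φ φ' hab
      (fun x hx => (hφd x (hsub hx)).continuousAt.continuousWithinAt)
      (fun x hx => hφd x (hsub (Ioo_subset_Icc_self hx))) ψ ψ'
      (fun x hx => (hψd x (hsub hx)).continuousAt.continuousWithinAt)
      (fun x hx => hψd x (hsub (Ioo_subset_Icc_self hx)))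
    have hc01 := hsub (Ioo_subset_Icc_self hc)
    have hne := (hφ'pos c hc01).ne'
    refine ⟨c, hc, ?_⟩
    rw [hr c hc01]
    field_simp
    linarith
  have hδmax : ∀ p ∈ Ioo (0:ℝ) 1, δ p ≤ δ pstar := by
    intro p hp
    rw [hδ p hp, hδ pstar hpstar]
    rcases lt_trichotomy p pstar with h | rfl | h
    · obtain ⟨c, hc, hψ⟩ := hmean p hp pstar hpstar h
      have h₁ := hrup ⟨hp.1, h⟩ ⟨hp.1.trans hc.1, hc.2⟩ hc.1.le
      have h₂ := hrmax c ⟨hp.1.trans hc.1, hc.2.trans hpstar.2⟩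
      nlinarith [mul_nonneg (hφpos pstar hpstar).le (sub_nonneg.2 h₂),
        mul_nonneg (hφpos p hp).le (sub_nonneg.2 h₁)]
    · exact le_rfl
    · obtain ⟨c, hc, hψ⟩ := hmean pstar hpstar p hp h
      have h₁ := hrdown ⟨hc.1, hc.2.trans hp.2⟩ ⟨h, hp.2⟩ hc.2.le
      have h₂ := hrmax c ⟨hpstar.1.trans hc.1, hc.2.trans hp.2⟩
      nlinarith [mul_nonneg (hφpos pstar hpstar).le (sub_nonneg.2 h₂),
        mul_nonneg (hφpos p hp).le (sub_nonneg.2 h₁)]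
  have hderiv : ∀ p ∈ Ioo (0:ℝ) 1,
      HasDerivAt (fun t => ψ t / φ t) (φ' p / φ p ^ 2 * δ p) p := by
    intro p hp
    have hne := (hφpos p hp).ne'
    have hne' := (hφ'pos p hp).ne'
    refine ((hψd p hp).div (hφd p hp) hne).congr_deriv ?_
    rw [hδ p hp, hr p hp]
    field_simp
  have hcoef : ∀ p ∈ Ioo (0:ℝ) 1, 0 < φ' p / φ p ^ 2 := fun p hp =>
    div_pos (hφ'pos p hp) (pow_pos (hφpos p hp) 2)
  constructor
  · intro hanti
    have hd := (hderiv pstar hpstar).hasDerivWithinAt (s := Ioo 0 1)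
    have hle := hanti.derivWithin_nonpos (x := pstar)
    rw [hd.derivWithin (isOpen_Ioo.uniqueDiffWithinAt hpstar)] at hle
    exact nonpos_of_mul_nonpos_right hle (hcoef pstar hpstar)
  · intro hle
    refine antitoneOn_of_hasDerivWithinAt_nonpos (convex_Ioo 0 1)
      (fun x hx => (hderiv x hx).continuousAt.continuousWithinAt)
      (fun x hx => (hderiv x (interior_subset hx)).hasDerivWithinAt) ?_
    intro x hx
    have hx' := interior_subset hx
    exact mul_nonpos_of_nonneg_of_nonpos (hcoef x hx').le ((hδmax x hx').trans hle)
end
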